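/- Let f(x) = ∏_{i=1}^n x_i (the product function on [0,1]^n) and define I(f,k) = −(n+1)(n+2) ∫_{[0,1]^n} f(x)·(x_{(k+1)} − 2x_{(k)} + x_{(k−1)}) dx (conventions x_{(0)}=0, x_{(n+1)}=1). Then for every k ∈ {1,...,n−1}, I(f, k+1) < I(f, k); i.e., the influence of the order statistics is strictly decreasing in k. -/

import Mathlib

open MeasureTheory Finset

/-- The `k`-th order statistic of `x : Fin n → ℝ`, with conventions
`oStat x 0 = 0` and `oStat x k = 1` for `k > n`. For `1 ≤ k ≤ n` it is the
`k`-th smallest coordinate of `x`. -/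
noncomputable def oStat {n : ℕ} (x : Fin n → ℝ) (k : ℕ) : ℝ :=
  if k = 0 then 0
  else if k ≤ n then ((Finset.univ.val.map x).sort (· ≤ ·)).getD (k - 1) 0
  else 1

/-- The `k`-th order statistic of the subfamily `(x i)_{i ∈ S}`. -/
noncomputable def oStatS {n : ℕ} (S : Finset (Fin n)) (x : Fin n → ℝ) (k : ℕ) : ℝ :=
  ((S.val.map x).sort (· ≤ ·)).getD (k - 1) 0

/-- The influence index `I(f,k)` of the `k`-th largest variable on `f`. -/
noncomputable def infl {n : ℕ} (f : (Fin n → ℝ) → ℝ) (k : ℕ) : ℝ :=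
  -((n:ℝ)+1)*((n:ℝ)+2) * ∫ x in Set.Icc (0:Fin n → ℝ) 1,
    f x * (oStat x (k+1) - 2*oStat x k + oStat x (k-1))

/-- The product `∏ i, x i` times the indicator of `{i | x i ≤ t} = S`, as a product over `i`. -/
noncomputable def levelWeight {n : ℕ} (S : Finset (Fin n)) (x : Fin n → ℝ) (t : ℝ) : ℝ :=
  ∏ i, x i * (if i ∈ S then (if x i ≤ t then 1 else 0) else (if t < x i then 1 else 0))

/-- The integral of `(t ^ 2) ^ m * (1 - t ^ 2) ^ (n - m)` over the unit interval. -/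
noncomputable def levelIntegral (n m : ℕ) : ℝ :=
  ∫ t in (0:ℝ)..1, (t ^ 2) ^ m * (1 - t ^ 2) ^ (n - m)

theorem lt_getElem_iff_countP_le {l : List ℝ} (hl : l.Pairwise (· ≤ ·)) (t : ℝ) (p : ℕ)
    (hp : p < l.length) : t < l[p] ↔ l.countP (fun a => decide (a ≤ t)) ≤ p := by
  induction l generalizing p with
  | nil => simp at hp
  | cons a l ih =>
    rw [List.pairwise_cons] at hl
    by_cases hat : a ≤ t
    · rw [List.countP_cons_of_pos (by simpa using hat)]
      cases p with
      | zero => simp [hat]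
      | succ p => simpa using ih hl.2 p (by simpa using hp)
    · have h0 : (a :: l).countP (fun a => decide (a ≤ t)) = 0 := by
        rw [List.countP_eq_zero]
        intro b hb
        rcases List.mem_cons.1 hb with rfl | hb
        · simpa using hat
        · have := hl.1 b hb
          simp only [decide_eq_true_eq]; linarith
      rw [h0]
      simp only [zero_le, iff_true]
      cases p with
      | zero => simpa using hat
      | succ p =>
        have := hl.1 _ (List.getElem_mem (Nat.lt_of_succ_lt_succ hp))
        simp only [List.getElem_cons_succ]; linarith

theorem oStat_eq_getElem {n : ℕ} (x : Fin n → ℝ) {j : ℕ} (hj : j ≠ 0) (hjn : j ≤ n) :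
    ∃ h : j - 1 < ((Finset.univ.val.map x).sort (· ≤ ·)).length,
      oStat x j = ((Finset.univ.val.map x).sort (· ≤ ·))[j - 1] := by
  have h : j - 1 < ((Finset.univ.val.map x).sort (· ≤ ·)).length := by
    simp; omega
  refine ⟨h, ?_⟩
  rw [oStat, if_neg hj, if_pos hjn, List.getD_eq_getElem _ _ h]

theorem lt_oStat_iff {n : ℕ} (x : Fin n → ℝ) (t : ℝ) {j : ℕ} (hj : j ≠ 0) (hjn : j ≤ n) :
    t < oStat x j ↔ #{i | x i ≤ t} < j := by
  obtain ⟨h, e⟩ := oStat_eq_getElem x hj hjn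
  rw [e, lt_getElem_iff_countP_le (Multiset.pairwise_sort _ _)]
  have : ((Finset.univ.val.map x).sort (· ≤ ·)).countP (fun a => decide (a ≤ t))
      = #{i | x i ≤ t} := by
    rw [← Multiset.coe_countP, Multiset.sort_eq, Multiset.countP_map]
    rfl
  rw [this]
  omega

theorem oStat_mem_Icc {n : ℕ} {x : Fin n → ℝ} (hx : x ∈ Set.Icc 0 1) (j : ℕ) :
    oStat x j ∈ Set.Icc (0:ℝ) 1 := by
  by_cases hj : j = 0
  · simp [oStat, hj]
  by_cases hjn : j ≤ n
  · obtain ⟨h, e⟩ := oStat_eq_getElem x hj hjn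
    rw [e]
    have hm := List.getElem_mem h
    rw [Multiset.mem_sort, Multiset.mem_map] at hm
    obtain ⟨i, -, hi⟩ := hm
    rw [← hi]
    exact ⟨hx.1 i, hx.2 i⟩
  · simp [oStat, hj, hjn]

theorem oStat_eq_integral {n : ℕ} {x : Fin n → ℝ} (hx : x ∈ Set.Icc 0 1) {j : ℕ}
    (hj : j ≤ n + 1) :
    oStat x j = ∫ t in Set.Icc (0:ℝ) 1, if #{i | x i ≤ t} < j then (1:ℝ) else 0 := by
  have ho := oStat_mem_Icc hx j
  have hind : ∀ t ∈ Set.Ico (0:ℝ) 1, (if #{i | x i ≤ t} < j then (1:ℝ) else 0)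
      = (Set.Iio (oStat x j)).indicator 1 t := by
    intro t ht
    have : #{i | x i ≤ t} < j ↔ t < oStat x j := by
      by_cases hj0 : j = 0
      · simp [oStat, hj0, ht.1]
      by_cases hjn : j ≤ n
      · exact (lt_oStat_iff x t hj0 hjn).symm
      · have hc : #{i | x i ≤ t} ≤ n := by simpa using Finset.card_filter_le univ (x · ≤ t)
        simp only [oStat, hj0, hjn, if_false, ht.2, iff_true]
        omega
    simp [Set.indicator_apply, this]
  rw [integral_Icc_eq_integral_Ico, setIntegral_congr_fun measurableSet_Ico hind,
    setIntegral_indicator measurableSet_Iio, Set.Ico_inter_Iio, min_eq_right ho.2]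
  simp [ho.1]

theorem levelWeight_eq {n : ℕ} (S : Finset (Fin n)) (x : Fin n → ℝ) (t : ℝ) :
    levelWeight S x t = if univ.filter (fun i => x i ≤ t) = S then ∏ i, x i else 0 := by
  rw [levelWeight, Finset.prod_mul_distrib]
  split_ifs with h
  · rw [Finset.prod_eq_one (s := univ) (f := fun i => if i ∈ S then _ else _), mul_one]
    intro i _
    subst h
    by_cases hi : x i ≤ t
    · simp [hi]
    · simp [hi, not_le.1 hi]
  · have : ∃ i, ¬ (x i ≤ t ↔ i ∈ S) := by
      by_contra! h'
      exact h (by ext i; simpa using h' i)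
    obtain ⟨i, hi⟩ := this
    refine mul_eq_zero_of_right _ (Finset.prod_eq_zero (mem_univ i) ?_)
    by_cases hS : i ∈ S
    · simp [hS] at hi ⊢
      exact hi
    · simp [hS] at hi ⊢
      exact hi

theorem sum_levelWeight {n : ℕ} (x : Fin n → ℝ) (t : ℝ) (j : ℕ) :
    ∑ m ∈ range j, ∑ S ∈ powersetCard m (univ : Finset (Fin n)), levelWeight S x t
      = (∏ i, x i) * if #{i | x i ≤ t} < j then (1:ℝ) else 0 := by
  simp only [levelWeight_eq, Finset.sum_ite_eq, mem_powersetCard, subset_univ, true_and]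
  simp

theorem measurable_levelWeight {n : ℕ} (S : Finset (Fin n)) :
    Measurable fun p : (Fin n → ℝ) × ℝ => levelWeight S p.1 p.2 := by
  unfold levelWeight
  refine Finset.measurable_prod _ fun i _ => Measurable.mul (by fun_prop) ?_
  split_ifs
  · exact Measurable.ite (measurableSet_le (by fun_prop) (by fun_prop))
      measurable_const measurable_const
  · exact Measurable.ite (measurableSet_lt (by fun_prop) (by fun_prop))
      measurable_const measurable_const

theorem integrable_levelWeight {n : ℕ} (S : Finset (Fin n)) :
    Integrable (fun p : (Fin n → ℝ) × ℝ => levelWeight S p.1 p.2)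
      ((volume.restrict (Set.Icc 0 1)).prod (volume.restrict (Set.Icc 0 1))) := by
  rw [Measure.prod_restrict]
  refine Measure.integrableOn_of_bounded (M := 1) ?_ (measurable_levelWeight S).aestronglyMeasurable ?_
  · exact (isCompact_Icc.prod isCompact_Icc).measure_lt_top.ne
  refine ae_restrict_of_forall_mem (measurableSet_Icc.prod measurableSet_Icc) ?_
  rintro ⟨x, t⟩ ⟨hx, -⟩
  rw [levelWeight_eq]
  split_ifs
  · rw [Real.norm_of_nonneg (Finset.prod_nonneg fun i _ => hx.1 i)]
    exact Finset.prod_le_one (fun i _ => hx.1 i) fun i _ => hx.2 i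
  · simp

theorem setIntegral_mul_indicator_le {t : ℝ} (ht : t ∈ Set.Icc (0:ℝ) 1) :
    ∫ y in Set.Icc (0:ℝ) 1, y * (if y ≤ t then 1 else 0) = t ^ 2 / 2 := by
  have : (fun y : ℝ => y * (if y ≤ t then 1 else 0)) = (Set.Iic t).indicator fun y => y := by
    ext y; simp [Set.indicator_apply]
  rw [this, integral_Icc_eq_integral_Ioc, setIntegral_indicator measurableSet_Iic,
    Set.Ioc_inter_Iic, min_eq_right ht.2, ← intervalIntegral.integral_of_le ht.1, integral_id]
  ring

theorem setIntegral_mul_indicator_lt {t : ℝ} (ht : t ∈ Set.Icc (0:ℝ) 1) :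
    ∫ y in Set.Icc (0:ℝ) 1, y * (if t < y then 1 else 0) = (1 - t ^ 2) / 2 := by
  have : (fun y : ℝ => y * (if t < y then 1 else 0)) = (Set.Ioi t).indicator fun y => y := by
    ext y; simp [Set.indicator_apply]
  rw [this, integral_Icc_eq_integral_Ioc, setIntegral_indicator measurableSet_Ioi,
    Set.Ioc_inter_Ioi, max_eq_right ht.1, ← intervalIntegral.integral_of_le ht.2, integral_id]
  ring

theorem integral_levelWeight {n : ℕ} (S : Finset (Fin n)) {t : ℝ} (ht : t ∈ Set.Icc (0:ℝ) 1) :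
    ∫ x in Set.Icc (0 : Fin n → ℝ) 1, levelWeight S x t
      = (1 / 2) ^ n * ((t ^ 2) ^ #S * (1 - t ^ 2) ^ (n - #S)) := by
  have hm : (volume : Measure (Fin n → ℝ)).restrict (Set.Icc 0 1)
      = Measure.pi fun _ => (volume : Measure ℝ).restrict (Set.Icc 0 1) := by
    rw [← Measure.restrict_pi_pi, Set.pi_univ_Icc]
    rfl
  rw [hm]
  unfold levelWeight
  rw [integral_fintype_prod_eq_prod (𝕜 := ℝ) (fun i y => y * (if i ∈ S then
    (if y ≤ t then 1 else 0) else (if t < y then 1 else 0)))]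
  have h : ∀ i, ∫ y in Set.Icc (0:ℝ) 1, y * (if i ∈ S then
      (if y ≤ t then 1 else 0) else (if t < y then 1 else 0))
      = 1 / 2 * if i ∈ S then t ^ 2 else 1 - t ^ 2 := by
    intro i
    split_ifs
    · rw [setIntegral_mul_indicator_le ht]; ring
    · rw [setIntegral_mul_indicator_lt ht]; ring
  simp only [h]
  rw [Finset.prod_mul_distrib, Finset.prod_ite]
  have hS : #({i | i ∉ S} : Finset (Fin n)) = n - #S := by
    rw [Finset.filter_notMem_eq_sdiff, Finset.card_univ_sdiff, Fintype.card_fin]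
  simp [hS]

theorem integral_integral_levelWeight {n : ℕ} (S : Finset (Fin n)) :
    ∫ x in Set.Icc (0 : Fin n → ℝ) 1, ∫ t in Set.Icc (0:ℝ) 1, levelWeight S x t
      = (1 / 2) ^ n * levelIntegral n #S := by
  rw [integral_integral_swap (integrable_levelWeight S),
    setIntegral_congr_fun measurableSet_Icc fun t ht => integral_levelWeight S ht,
    integral_const_mul, levelIntegral, intervalIntegral.integral_of_le zero_le_one,
    integral_Icc_eq_integral_Ioc]

theorem prod_mul_oStat_eq {n j : ℕ} (hj : j ≤ n + 1) {x : Fin n → ℝ} (hx : x ∈ Set.Icc 0 1) :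
    (∏ i, x i) * oStat x j = ∑ m ∈ range j, ∑ S ∈ powersetCard m (univ : Finset (Fin n)),
      ∫ t in Set.Icc (0:ℝ) 1, levelWeight S x t := by
  have hlevel (S : Finset (Fin n)) :
      Integrable (levelWeight S x) (volume.restrict (Set.Icc (0:ℝ) 1)) := by
    refine Integrable.of_bound ((measurable_levelWeight S).comp
      measurable_prodMk_left).aestronglyMeasurable (∏ i, x i) (ae_of_all _ fun t => ?_)
    have h0 : 0 ≤ ∏ i, x i := Finset.prod_nonneg fun i _ => hx.1 i
    simp only [levelWeight_eq]
    split_ifs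
    · exact (Real.norm_of_nonneg h0).le
    · simpa using h0
  rw [oStat_eq_integral hx hj, ← integral_const_mul]
  simp only [← sum_levelWeight]
  rw [integral_finsetSum _ fun m _ => integrable_finsetSum _ fun S _ => hlevel S]
  exact Finset.sum_congr rfl fun m _ => integral_finsetSum _ fun S _ => hlevel S

theorem integrableOn_prod_mul_oStat {n j : ℕ} (hj : j ≤ n + 1) :
    IntegrableOn (fun x : Fin n → ℝ => (∏ i, x i) * oStat x j) (Set.Icc 0 1) := by
  refine IntegrableOn.congr_fun ?_ (fun x hx => (prod_mul_oStat_eq hj hx).symm) measurableSet_Icc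
  exact integrable_finsetSum _ fun m _ => integrable_finsetSum _ fun S _ =>
    (integrable_levelWeight S).integral_prod_left

theorem setIntegral_prod_mul_oStat {n j : ℕ} (hj : j ≤ n + 1) :
    ∫ x in Set.Icc (0 : Fin n → ℝ) 1, (∏ i, x i) * oStat x j
      = ∑ m ∈ range j, (1 / 2) ^ n * (n.choose m * levelIntegral n m) := by
  have hlevel (S : Finset (Fin n)) := (integrable_levelWeight S).integral_prod_left
  rw [setIntegral_congr_fun measurableSet_Icc fun x hx => prod_mul_oStat_eq hj hx,
    integral_finsetSum _ fun m _ => integrable_finsetSum _ fun S _ => hlevel S]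
  refine Finset.sum_congr rfl fun m _ => ?_
  rw [integral_finsetSum _ fun S _ => hlevel S, Finset.sum_congr rfl fun S hS => by
    rw [integral_integral_levelWeight, (mem_powersetCard.1 hS).2]]
  rw [Finset.sum_const, card_powersetCard, card_univ, Fintype.card_fin, nsmul_eq_mul]
  ring

theorem infl_prod_eq {n k : ℕ} (hk : k + 1 ≤ n) :
    infl (fun x : Fin n → ℝ => ∏ i, x i) (k + 1) = ((n:ℝ) + 1) * (n + 2) * (1 / 2) ^ n *
      (n.choose k * levelIntegral n k - n.choose (k + 1) * levelIntegral n (k + 1)) := by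
  have h (j : ℕ) (hj : j ≤ n + 1) := integrableOn_prod_mul_oStat hj
  have e (x : Fin n → ℝ) : (∏ i, x i) * (oStat x (k + 1 + 1) - 2 * oStat x (k + 1) +
      oStat x (k + 1 - 1)) = (∏ i, x i) * oStat x (k + 2) - 2 * ((∏ i, x i) * oStat x (k + 1))
        + (∏ i, x i) * oStat x k := by
    rw [Nat.add_sub_cancel]; ring
  simp only [infl, e]
  rw [integral_add
      (f := fun x => (∏ i, x i) * oStat x (k + 2) - 2 * ((∏ i, x i) * oStat x (k + 1)))
      ((h _ (by omega)).integrable.sub ((h _ (by omega)).integrable.const_mul 2)) (h _ (by omega)),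
    integral_sub (h _ (by omega)) ((h _ (by omega)).const_mul 2), integral_const_mul,
    setIntegral_prod_mul_oStat (by omega), setIntegral_prod_mul_oStat (by omega),
    setIntegral_prod_mul_oStat (by omega)]
  simp only [Finset.sum_range_succ]
  ring

theorem levelIntegral_succ {n k : ℕ} (hk : k + 1 ≤ n) :
    2 * ((n:ℝ) - k) * levelIntegral n (k + 1) = (2 * k + 1) * levelIntegral n k := by
  obtain ⟨d, rfl⟩ := Nat.exists_eq_add_of_le hk
  have hderiv (t : ℝ) : HasDerivAt (fun t : ℝ => t ^ (2 * k + 1) * (1 - t ^ 2) ^ (d + 1))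
      ((2 * k + 1) * ((t ^ 2) ^ k * (1 - t ^ 2) ^ (d + 1))
        - 2 * (d + 1) * ((t ^ 2) ^ (k + 1) * (1 - t ^ 2) ^ d)) t := by
    refine ((hasDerivAt_pow (2 * k + 1) t).mul
      (((hasDerivAt_pow 2 t).const_sub 1).pow (d + 1))).congr_deriv ?_
    simp only [Nat.add_sub_cancel, Pi.pow_apply]
    push_cast
    ring
  have hc (c : ℝ) (a b : ℕ) :
      IntervalIntegrable (fun t : ℝ => c * ((t ^ 2) ^ a * (1 - t ^ 2) ^ b)) volume 0 1 :=
    Continuous.intervalIntegrable (by fun_prop) _ _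
  have := intervalIntegral.integral_eq_sub_of_hasDerivAt (a := 0) (b := 1)
    (fun t _ => hderiv t) ((hc _ _ _).sub (hc _ _ _))
  rw [intervalIntegral.integral_sub (hc _ _ _) (hc _ _ _), intervalIntegral.integral_const_mul,
    intervalIntegral.integral_const_mul] at this
  simp only [levelIntegral, show k + 1 + d - k = d + 1 by omega, Nat.add_sub_cancel_left]
  push_cast
  norm_num at this
  linarith

theorem levelIntegral_pos (n k : ℕ) : 0 < levelIntegral n k := by
  refine intervalIntegral.intervalIntegral_pos_of_pos_on
    (Continuous.intervalIntegrable (by fun_prop) _ _) (fun t ht => ?_) zero_lt_one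
  have h1 : 0 < 1 - t ^ 2 := by nlinarith [ht.1, ht.2]
  have h2 := ht.1
  positivity

theorem choose_mul_levelIntegral_succ {n k : ℕ} (hk : k + 1 ≤ n) :
    2 * ((k:ℝ) + 1) * (n.choose (k + 1) * levelIntegral n (k + 1))
      = (2 * k + 1) * (n.choose k * levelIntegral n k) := by
  have h : (n.choose (k + 1) : ℝ) * (k + 1) = n.choose k * (n - k) := by
    have := Nat.choose_succ_right_eq n k
    rw [← Nat.cast_sub (by omega : k ≤ n)]
    exact_mod_cast this
  linear_combination 2 * levelIntegral n (k + 1) * h + (n.choose k : ℝ) * levelIntegral_succ hk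

theorem stmt17 (n : ℕ) (hn : 2 ≤ n) (k : ℕ) (hk : 1 ≤ k) (hkn : k ≤ n - 1) :
    infl (fun x : Fin n → ℝ => ∏ i, x i) (k + 1) <
      infl (fun x : Fin n → ℝ => ∏ i, x i) k := by
  obtain ⟨k, rfl⟩ := Nat.exists_eq_add_of_le' hk
  rw [infl_prod_eq (by omega), infl_prod_eq (by omega)]
  have h1 := choose_mul_levelIntegral_succ (n := n) (k := k) (by omega)
  have h2 := choose_mul_levelIntegral_succ (n := n) (k := k + 1) (by omega)
  have h0 : 0 < n.choose k * levelIntegral n k :=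
    mul_pos (by exact_mod_cast Nat.choose_pos (by omega)) (levelIntegral_pos n k)
  refine mul_lt_mul_of_pos_left ?_ (by positivity)
  generalize (n.choose k : ℝ) * levelIntegral n k = a at *
  generalize (n.choose (k + 1) : ℝ) * levelIntegral n (k + 1) = b at *
  generalize (n.choose (k + 1 + 1) : ℝ) * levelIntegral n (k + 1 + 1) = c at *
  push_cast at h2
  have hb : b = (2 * k + 1) * a / (2 * (k + 1)) := by
    rw [eq_div_iff (by positivity)]; linarith
  have hc : c = (2 * (k + 1) + 1) * b / (2 * (k + 1 + 1)) := by
    rw [eq_div_iff (by positivity)]; linarith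
  have : a - b - (b - c) = 3 * a / (4 * (k + 1) * (k + 2)) := by
    rw [hc, hb]
    field_simp
    ring
  have : 0 < a - b - (b - c) := this ▸ by positivity
  linarith
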